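/- Let G = ℝ^{n+1} be a Grushin space of homogeneous dimension Q = n+2 with Q ≥ 4, and let 2 ≤ p < ∞. Then for every u ∈ C_0^∞(B_1^Q(o) ∖ {o}): ∫_{B_1^Q(o)} |∇_{ϱ,G} u|^p / ϱ^{Q−p} dx dt − ((p−1)/p)^p ∫_{B_1^Q(o)} |u|^p ψ^{p/2} / (ϱ^{Q} (ln(1/ϱ))^{p}) dx dt ≥ c_p ((p−1)/p)^p · sup_{R>0} d_C(u,R)^p. -/

import Mathlib

open MeasureTheory Real

noncomputable section

/-- Points of the Grushin space `ℝ^{n+1}`. -/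
abbrev GPt (n : ℕ) := EuclideanSpace ℝ (Fin n) × ℝ

/-- Homogeneous Grushin norm `ϱ(x,t) = (|x|⁴ + 4t²)^{1/4}`. -/
def gNorm {n : ℕ} (z : GPt n) : ℝ := (‖z.1‖ ^ 4 + 4 * z.2 ^ 2) ^ ((1 : ℝ) / 4)

/-- The geometric term `ψ(x,t) = |x|²/ϱ²` (so that `|∇_G ϱ| = ψ^{1/2}`). -/
def gPsi {n : ℕ} (z : GPt n) : ℝ := ‖z.1‖ ^ 2 / gNorm z ^ 2

/-- Radial derivative `∂_ϱ u(x,t) = d/ds u(s·x/ϱ, s²·t/ϱ²)` at `s = ϱ(x,t)`. -/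
def radialDeriv {n : ℕ} (u : GPt n → ℝ) (z : GPt n) : ℝ :=
  deriv (fun s : ℝ => u ((s / gNorm z) • z.1, (s ^ 2 / gNorm z ^ 2) * z.2)) (gNorm z)

/-- The scaled function `u_R(x,t) = u(R·x/ϱ, R²·t/ϱ²)`. -/
def uScaled {n : ℕ} (R : ℝ) (u : GPt n → ℝ) (z : GPt n) : ℝ :=
  u ((R / gNorm z) • z.1, (R ^ 2 / gNorm z ^ 2) * z.2)

/-- Radial Grushin operator `L_{ϱ,G} u = ψ(∂_ϱ² u + ((Q−1)/ϱ) ∂_ϱ u)`. -/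
def radialLap {n : ℕ} (Q : ℝ) (u : GPt n → ℝ) (z : GPt n) : ℝ :=
  gPsi z * (radialDeriv (radialDeriv u) z + (Q - 1) / gNorm z * radialDeriv u z)

/-- The Grushin operator `L_G u = Δ_x u + |x|² ∂_t² u`. -/
def grushinOp {n : ℕ} (u : GPt n → ℝ) (z : GPt n) : ℝ :=
  (∑ i : Fin n,
      deriv (deriv fun s : ℝ => u (z.1 + s • EuclideanSpace.single i (1 : ℝ), z.2)) 0)
    + ‖z.1‖ ^ 2 * deriv (deriv fun s : ℝ => u (z.1, z.2 + s)) 0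

/-- The first-order operator `T_β(u) = ψ^{1/2}(∂_ϱ u + ((Q−β−2)/(2ϱ)) u)`. -/
def Tweight {n : ℕ} (Q β : ℝ) (u : GPt n → ℝ) (z : GPt n) : ℝ :=
  Real.sqrt (gPsi z) * (radialDeriv u z + (Q - β - 2) / (2 * gNorm z) * u z)

/-- The iterated operator `R_{β,k} = T_β ∘ T_{β+2} ∘ ⋯ ∘ T_{β+2k}`. -/
def Rop {n : ℕ} (Q : ℝ) : ℕ → ℝ → (GPt n → ℝ) → GPt n → ℝ
  | 0, β, u => Tweight Q β u
  | k + 1, β, u => Tweight Q β (Rop Q k (β + 2) u)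

/-- The constants `Λ_k(Q,p,β)`. -/
def Lam (Q p β : ℝ) (k : ℕ) : ℝ :=
  if k = 1 then ((Q - p - β) / p) ^ p
  else ((Q * (p - 1) + β + ((k : ℝ) - 2) * p) * (Q - β - (k : ℝ) * p) / p ^ 2) ^ p

/-- The constant `C_{2l,p,β} = ∏_{i=1}^{l} Λ_{2i}(Q,p,β)`. -/
def Ceven (Q p β : ℝ) (l : ℕ) : ℝ := ∏ i ∈ Finset.range l, Lam Q p β (2 * i + 2)

/-- The constant `C_{2l+1,p,β} = ∏_{i=0}^{l} Λ_{2i+1}(Q,p,β)`. -/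
def Codd (Q p β : ℝ) (l : ℕ) : ℝ := ∏ i ∈ Finset.range (l + 1), Lam Q p β (2 * i + 1)

/-- The constant `A_m = ((Q+m)² + (Q−4−m)²)/4`. -/
def Aconst (Q m : ℝ) : ℝ := ((Q + m) ^ 2 + (Q - 4 - m) ^ 2) / 4

/-- The constants `D_{j,m,β}` given by the iteration
`D_{j,m+1,β} = Λ_{2m+2}(Q,2,β) D_{j−2,m,β} + A_{β+4m} D_{j−1,m,β} + D_{j,m,β}`,
with `D_{0,0,β} = 1` (and vanishing off-range values). -/
def Dconst (Q β : ℝ) : ℕ → ℤ → ℝ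
  | 0, j => if j = 0 then 1 else 0
  | m + 1, j =>
      Lam Q 2 β (2 * m + 2) * Dconst Q β m (j - 2)
        + Aconst Q (β + 4 * (m : ℝ)) * Dconst Q β m (j - 1) + Dconst Q β m j

/-- The constants `B_{j,m,β,k}` given by the iteration
`B_{j,m+1,β,k} = Λ_2(Q,2,β+2k+2) B_{j−2,m,β+4,k} + A_{β+2k+2} B_{j−1,m,β+2,k+1} + B_{j,m,β,k+2}`,
with `B_{0,0,β,k} = 1` (and vanishing off-range values). -/
def Bconst (Q : ℝ) : ℕ → ℤ → ℝ → ℝ → ℝ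
  | 0, j, _, _ => if j = 0 then 1 else 0
  | m + 1, j, β, k =>
      Lam Q 2 (β + 2 * k + 2) 2 * Bconst Q m (j - 2) (β + 4) k
        + Aconst Q (β + 2 * k + 2) * Bconst Q m (j - 1) (β + 2) (k + 1)
        + Bconst Q m j β (k + 2)

/-- Surface measure `ω_n` of the unit sphere in `ℝ^n`. -/
def sphSurface (n : ℕ) : ℝ :=
  n * (volume (Metric.ball (0 : EuclideanSpace ℝ (Fin n)) 1)).toReal

/-- The integral constant `C^{Ω,m} = ω_n ∫_0^π (sin φ)^{(n+m)/2} dφ`. -/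
def COmega (n m : ℕ) : ℝ :=
  sphSurface n * ∫ φ in (0 : ℝ)..π, Real.sin φ ^ (((n : ℝ) + (m : ℝ)) / 2)

/-- The sharp Frank–Seiringer constant `c_p = min_{0<t≤1/2} [(1−t)^p − t^p + p t^{p−1}]`. -/
def cFS (p : ℝ) : ℝ :=
  sInf {y : ℝ | ∃ t : ℝ, 0 < t ∧ t ≤ 1 / 2 ∧ y = (1 - t) ^ p - t ^ p + p * t ^ (p - 1)}

/-- Compactly supported smooth test functions with (closed) support inside `s`. -/
def IsTest {n : ℕ} (s : Set (GPt n)) (u : GPt n → ℝ) : Prop :=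
  ContDiff ℝ (⊤ : ℕ∞) u ∧ HasCompactSupport u ∧ tsupport u ⊆ s

/-- A function on the Grushin space is radial if it depends only on the homogeneous norm. -/
def IsRadial {n : ℕ} (u : GPt n → ℝ) : Prop :=
  ∃ f : ℝ → ℝ, ∀ z, u z = f (gNorm z)

/-- The distance function `d_H(u,R)`. -/
def dH {n : ℕ} (Q p β R : ℝ) (u : GPt n → ℝ) : ℝ :=
  (∫ z : GPt n,
      |u z - R ^ ((Q - p - β) / p) * uScaled R u z * gNorm z ^ (-((Q - p - β) / p))| ^ p *
        gPsi z ^ (p / 2) / (|Real.log (R / gNorm z)| ^ p * gNorm z ^ (p + β))) ^ (1 / p)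

/-- The distance function `d_R(u,k,β)`. -/
def dRdist {n : ℕ} (Q p β R : ℝ) (k : ℕ) (u : GPt n → ℝ) : ℝ :=
  (∫ z : GPt n,
      (|u z| ^ ((p - 2) / 2) * u z -
          |uScaled R u z| ^ ((p - 2) / 2) * uScaled R u z *
            (gNorm z / R) ^ (-((Q - (k : ℝ) * p - β) / 2))) ^ 2 *
        gPsi z ^ (p / 2) /
        (gNorm z ^ ((k : ℝ) * p + β) * Real.log (R / gNorm z) ^ 2)) ^ ((1 : ℝ) / 2)

/-- The distance function `d_C(u,R)`. -/
def dCdist {n : ℕ} (Q p R : ℝ) (u : GPt n → ℝ) : ℝ :=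
  (∫ z in {z : GPt n | gNorm z < 1},
      |u z - Real.log (1 / gNorm z) ^ ((p - 1) / p) * R ^ ((p - 1) / p) *
          uScaled (Real.exp (-1 / R)) u z| ^ p *
        gPsi z ^ (p / 2) /
        (gNorm z ^ Q * Real.log (1 / gNorm z) ^ p *
          |Real.log (R * Real.log (1 / gNorm z))| ^ p)) ^ (1 / p)

theorem cFS_lower {p t : ℝ} (hp : 2 ≤ p) (ht : 0 < t) (ht2 : t ≤ 1 / 2) :
    0 ≤ (1 - t) ^ p - t ^ p + p * t ^ (p - 1) := by
  have h1 : t ^ p ≤ (1 - t) ^ p := by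
    apply Real.rpow_le_rpow <;> linarith
  have h2 : 0 ≤ p * t ^ (p - 1) := by positivity
  linarith

theorem cFS_nonneg {p : ℝ} (hp : 2 ≤ p) : 0 ≤ cFS p := by
  apply Real.sInf_nonneg
  rintro y ⟨t, ht, ht2, rfl⟩
  exact cFS_lower hp ht ht2

theorem cFS_le {p t : ℝ} (hp : 2 ≤ p) (ht : 0 < t) (ht2 : t ≤ 1 / 2) :
    cFS p ≤ (1 - t) ^ p - t ^ p + p * t ^ (p - 1) := by
  refine csInf_le ⟨0, ?_⟩ ⟨t, ht, ht2, rfl⟩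
  rintro y ⟨t, ht, ht2, rfl⟩
  exact cFS_lower hp ht ht2

theorem cFS_le_one {p : ℝ} (hp : 2 ≤ p) : cFS p ≤ 1 := by
  apply le_of_forall_pos_le_add
  intro ε hε
  have hp0 : 0 < p := by linarith
  set t := min (1 / 2) (ε / p) with ht
  have ht0 : 0 < t := lt_min (by norm_num) (by positivity)
  have ht1 : t ≤ 1 / 2 := min_le_left _ _
  have ht2 : p * t ≤ ε := by
    have : t ≤ ε / p := min_le_right _ _
    rwa [le_div_iff₀ hp0, mul_comm] at this
  have h1 : (1 - t) ^ p ≤ 1 := Real.rpow_le_one (by linarith) (by linarith) hp0.le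
  have h2 : t ^ (p - 1) ≤ t := by
    have := Real.rpow_le_rpow_of_exponent_ge ht0 (by linarith : t ≤ 1)
      (by linarith : (1 : ℝ) ≤ p - 1)
    rwa [Real.rpow_one] at this
  have h3 : 0 ≤ t ^ p := by positivity
  have h4 : p * t ^ (p - 1) ≤ p * t := by gcongr
  linarith [cFS_le hp ht0 ht1]

/-- Tangent line inequality for `x ↦ |x|^p`. -/
theorem tangent_le_abs_rpow {p : ℝ} (hp : 1 < p) (a b : ℝ) :
    |a| ^ p + p * |a| ^ (p - 2) * a * (b - a) ≤ |b| ^ p := by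
  have hc : ConvexOn ℝ Set.univ fun x : ℝ => |x| ^ p := by
    refine ConvexOn.comp (g := fun x : ℝ => x ^ p) (f := fun x : ℝ => |x|)
      ((convexOn_rpow hp.le).subset ?_ ?_) (convexOn_norm convex_univ) ?_
    · rintro _ ⟨x, -, rfl⟩
      exact abs_nonneg x
    · rw [show (fun x : ℝ => |x|) '' Set.univ = Set.Ici 0 from ?_]
      · exact convex_Ici 0
      · ext x
        exact ⟨by rintro ⟨y, -, rfl⟩; exact abs_nonneg y, fun h => ⟨x, trivial, abs_of_nonneg h⟩⟩
    · rintro _ ⟨x, -, rfl⟩ _ ⟨y, -, rfl⟩ h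
      exact Real.rpow_le_rpow (abs_nonneg x) h (by linarith)
  have hd := hasDerivAt_abs_rpow a hp
  rcases lt_trichotomy a b with h | rfl | h
  · have := hc.le_slope_of_hasDerivAt trivial trivial h hd
    rw [slope_def_field, le_div_iff₀ (by linarith)] at this
    linarith
  · simp
  · have := hc.slope_le_of_hasDerivAt trivial trivial h hd
    rw [slope_def_field, div_le_iff₀ (by linarith)] at this
    linarith

theorem cFS_le_of_nonpos {p s : ℝ} (hp : 2 ≤ p) (hs : 0 ≤ s) :
    1 ≤ (1 + s) ^ p - s ^ p - p * s ^ (p - 1) := by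
  have hmono : MonotoneOn (fun s : ℝ => (1 + s) ^ p - s ^ p - p * s ^ (p - 1)) (Set.Ici 0) := by
    have hder : ∀ x : ℝ, 0 < x → HasDerivAt
        (fun s : ℝ => (1 + s) ^ p - s ^ p - p * s ^ (p - 1))
        (p * (1 + x) ^ (p - 1) - p * x ^ (p - 1) - p * ((p - 1) * x ^ (p - 2))) x := by
      intro x hx
      have h1 := ((hasDerivAt_id x).const_add 1).rpow_const (p := p) (Or.inr (by linarith))
      have h2 := (hasDerivAt_id x).rpow_const (p := p) (Or.inr (by linarith))
      have h3 := ((hasDerivAt_id x).rpow_const (p := p - 1) (Or.inr (by linarith))).const_mul p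
      refine ((h1.sub h2).sub h3).congr_deriv ?_
      rw [show p - 1 - 1 = p - 2 by ring]
      simp
    apply monotoneOn_of_deriv_nonneg (convex_Ici 0)
    · apply Continuous.continuousOn
      have : 0 ≤ p := by linarith
      have : 0 ≤ p - 1 := by linarith
      fun_prop (disch := assumption)
    · intro x hx
      rw [interior_Ici] at hx
      exact (hder x hx).differentiableAt.differentiableWithinAt
    · intro x hx
      rw [interior_Ici] at hx
      rw [(hder x hx).deriv]
      have hx : 0 < x := hx
      have hB := one_add_mul_self_le_rpow_one_add (s := 1 / x) (p := p - 1)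
        (by have : 0 < 1 / x := by positivity
            linarith) (by linarith)
      have e1 : (1 + x) ^ (p - 1) = x ^ (p - 1) * (1 + 1 / x) ^ (p - 1) := by
        rw [← Real.mul_rpow hx.le (by positivity)]
        congr 1; field_simp; ring
      have e2 : x ^ (p - 2) = x ^ (p - 1) * (1 / x) := by
        rw [show p - 2 = p - 1 - 1 by ring, Real.rpow_sub_one hx.ne']; ring
      have hx1 : 0 ≤ x ^ (p - 1) := by positivity
      have := mul_le_mul_of_nonneg_left hB (mul_nonneg (by linarith : 0 ≤ p) hx1)
      rw [e1, e2]
      nlinarith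
  have h := hmono (Set.self_mem_Ici) hs hs
  have hp0 : p ≠ 0 := by linarith
  have hp1 : p - 1 ≠ 0 := by linarith
  simpa [Real.zero_rpow hp0, Real.zero_rpow hp1] using h

theorem cFS_le_of_half_le {p a : ℝ} (hp : 2 ≤ p) (ha : 1 / 2 ≤ a) :
    cFS p ≤ |a - 1| ^ p - a ^ p + p * a ^ (p - 1) := by
  have hmono : MonotoneOn (fun a : ℝ => |a - 1| ^ p - a ^ p + p * a ^ (p - 1))
      (Set.Ici (1 / 2)) := by
    have hder : ∀ x : ℝ, 1 / 2 < x → HasDerivAt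
        (fun a : ℝ => |a - 1| ^ p - a ^ p + p * a ^ (p - 1))
        (p * |x - 1| ^ (p - 2) * (x - 1) - p * x ^ (p - 1) + p * ((p - 1) * x ^ (p - 2))) x := by
      intro x hx
      have h1 := (hasDerivAt_abs_rpow (x - 1) (p := p) (by linarith)).comp x
        ((hasDerivAt_id x).sub_const 1)
      have h2 := (hasDerivAt_id x).rpow_const (p := p) (Or.inr (by linarith))
      have h3 := ((hasDerivAt_id x).rpow_const (p := p - 1) (Or.inr (by linarith))).const_mul p
      refine ((h1.sub h2).add h3).congr_deriv ?_
      rw [show p - 1 - 1 = p - 2 by ring]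
      simp
    apply monotoneOn_of_deriv_nonneg (convex_Ici _)
    · apply Continuous.continuousOn
      have : 0 ≤ p := by linarith
      have : 0 ≤ p - 1 := by linarith
      fun_prop (disch := assumption)
    · intro x hx
      rw [interior_Ici] at hx
      exact (hder x hx).differentiableAt.differentiableWithinAt
    · intro x hx
      rw [interior_Ici] at hx
      rw [(hder x hx).deriv]
      have hx : 1 / 2 < x := hx
      have hx0 : 0 < x := by linarith
      have e1 : x ^ (p - 1) = x ^ (p - 2) * x := by
        rw [show p - 1 = p - 2 + 1 by ring, Real.rpow_add_one hx0.ne']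
      have hxp : 0 ≤ x ^ (p - 2) := by positivity
      have key : 0 ≤ |x - 1| ^ (p - 2) * (x - 1) - x ^ (p - 1) + (p - 1) * x ^ (p - 2) := by
        rcases le_total x 1 with h | h
        · have h1 : |x - 1| ^ (p - 2) ≤ x ^ (p - 2) := by
            apply Real.rpow_le_rpow (abs_nonneg _) _ (by linarith)
            rw [abs_sub_comm, abs_of_nonneg (by linarith)]
            linarith
          have := mul_le_mul_of_nonneg_right h1 (by linarith : 0 ≤ 1 - x)
          rw [e1]
          nlinarith
        · have hB := one_add_mul_self_le_rpow_one_add (s := -1 / x) (p := p - 1)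
            (by rw [le_div_iff₀ hx0]; linarith) (by linarith)
          have e2 : |x - 1| ^ (p - 2) * (x - 1) = x ^ (p - 1) * (1 + -1 / x) ^ (p - 1) := by
            rw [← Real.mul_rpow hx0.le (by
              rw [show 1 + -1 / x = (x - 1) / x by field_simp; ring]
              exact div_nonneg (by linarith) hx0.le)]
            rw [show x * (1 + -1 / x) = x - 1 by field_simp; ring,
              abs_of_nonneg (by linarith : 0 ≤ x - 1)]
            rcases h.eq_or_lt with h | h
            · subst h; simp [Real.zero_rpow (by linarith : p - 1 ≠ 0)]
            · rw [← Real.rpow_add_one (by linarith)]; congr 1; ring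
          have := mul_le_mul_of_nonneg_left hB (Real.rpow_nonneg hx0.le (p - 1))
          have e3 : x ^ (p - 1) * (1 + (p - 1) * (-1 / x)) =
              x ^ (p - 1) - (p - 1) * x ^ (p - 2) := by
            rw [e1]; field_simp; ring
          rw [e2]
          linarith
      have := mul_nonneg (by linarith : 0 ≤ p) key
      linarith
  have h := hmono Set.self_mem_Ici ha ha
  refine le_trans (cFS_le (t := 1 / 2) hp (by norm_num) le_rfl) (le_trans (le_of_eq ?_) h)
  norm_num [abs_of_nonneg, abs_of_neg]

theorem cFS_le_normalized {p : ℝ} (hp : 2 ≤ p) (a : ℝ) :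
    cFS p ≤ |a - 1| ^ p - |a| ^ p + p * |a| ^ (p - 2) * a := by
  have e : ∀ x : ℝ, 0 ≤ x → x ^ (p - 2) * x = x ^ (p - 1) := by
    intro x hx
    rcases hx.eq_or_lt with h | h
    · subst h; simp [Real.zero_rpow (by linarith : p - 1 ≠ 0)]
    · rw [← Real.rpow_add_one h.ne']; congr 1; ring
  rcases le_or_gt a 0 with h | h
  · have := cFS_le_of_nonpos hp (neg_nonneg.2 h)
    rw [abs_of_nonpos h, abs_of_nonpos (by linarith : a - 1 ≤ 0), show -(a - 1) = 1 + -a by ring]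
    rw [← e (-a) (by linarith)] at this
    linarith [cFS_le_one hp]
  · rw [abs_of_pos h, mul_assoc, e a h.le]
    rcases le_total a (1 / 2) with h' | h'
    · rw [abs_of_nonpos (by linarith), neg_sub]
      exact cFS_le hp h h'
    · exact cFS_le_of_half_le hp h'

theorem cFS_mul_abs_rpow_le {p : ℝ} (hp : 2 ≤ p) (a b : ℝ) :
    |a| ^ p + p * |a| ^ (p - 2) * a * b + cFS p * |b| ^ p ≤ |a + b| ^ p := by
  rcases eq_or_ne b 0 with rfl | hb
  · simp [Real.zero_rpow (by linarith : p ≠ 0)]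
  have h := mul_le_mul_of_nonneg_left (cFS_le_normalized hp (-a / b))
    (Real.rpow_nonneg (abs_nonneg b) p)
  have hb' : 0 < |b| := abs_pos.2 hb
  have e1 : |b| ^ p * |-a / b - 1| ^ p = |a + b| ^ p := by
    rw [← Real.mul_rpow (abs_nonneg _) (abs_nonneg _), ← abs_mul, ← abs_neg]
    congr 2; field_simp; ring
  have e2 : |b| ^ p * |-a / b| ^ p = |a| ^ p := by
    rw [← Real.mul_rpow (abs_nonneg _) (abs_nonneg _), ← abs_mul, ← abs_neg]
    congr 2; field_simp
  have e3 : |b| ^ p * (|-a / b| ^ (p - 2) * (-a / b)) = -(|a| ^ (p - 2) * a * b) := by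
    have : |b| ^ p = |b| ^ (p - 2) * b ^ 2 := by
      rw [← sq_abs b, ← Real.rpow_natCast, ← Real.rpow_add hb']; congr 1; norm_num
    rw [this, abs_div, abs_neg, Real.div_rpow (abs_nonneg _) (abs_nonneg _)]
    field_simp
  have : |b| ^ p * (|-a / b - 1| ^ p - |-a / b| ^ p + p * |-a / b| ^ (p - 2) * (-a / b)) =
      |a + b| ^ p - |a| ^ p - p * (|a| ^ (p - 2) * a * b) := by
    rw [← e1, ← e2]
    linear_combination p * e3
  linarith

theorem continuous_dslope_of_contDiff {w : ℝ → ℝ} (hw : ContDiff ℝ 1 w) (τ₀ : ℝ) :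
    Continuous (dslope w τ₀) := by
  rw [continuous_iff_continuousAt]
  intro t
  rcases eq_or_ne t τ₀ with rfl | h
  · exact continuousAt_dslope_same.2 (hw.differentiable one_ne_zero t)
  · exact (continuousAt_dslope_of_ne h).2 hw.continuous.continuousAt

theorem abs_rpow_sub_two_mul_self_mul_self {p : ℝ} (hp : 2 ≤ p) (x : ℝ) :
    |x| ^ (p - 2) * x * x = |x| ^ p := by
  rcases eq_or_ne x 0 with rfl | h
  · simp [Real.zero_rpow (by linarith : p ≠ 0)]
  · rw [mul_assoc, ← sq, ← sq_abs, ← Real.rpow_natCast, ← Real.rpow_add (abs_pos.2 h)]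
    congr 1; norm_num

theorem integrable_abs_rpow {f : ℝ → ℝ} (hf : Continuous f) (hc : HasCompactSupport f) {p : ℝ}
    (hp : 0 < p) : Integrable fun x => |f x| ^ p := by
  have h : Continuous fun x => |f x| ^ p := by
    have := hp.le
    fun_prop (disch := assumption)
  exact h.integrable_of_hasCompactSupport
    (hc.comp_left (g := fun x : ℝ => |x| ^ p) (by simp [Real.zero_rpow hp.ne']))

/-- One-dimensional Hardy inequality at an interior point. -/
theorem hardy_dslope {p : ℝ} (hp : 2 ≤ p) {w : ℝ → ℝ} (hw : ContDiff ℝ 1 w)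
    (hc : HasCompactSupport w) (τ₀ : ℝ) :
    Integrable (fun t => |dslope w τ₀ t| ^ p) ∧
      ((p - 1) / p) ^ p * ∫ t, |dslope w τ₀ t| ^ p ≤ ∫ t, |deriv w t| ^ p := by
  set κ := (p - 1) / p with hκ
  have hp0 : 0 < p := by linarith
  have hκ0 : 0 < κ := div_pos (by linarith) hp0
  set q := dslope w τ₀ with hq
  have hqc : Continuous q := continuous_dslope_of_contDiff hw τ₀
  have hdc : Continuous (deriv w) := hw.continuous_deriv le_rfl
  have h2 : 0 ≤ p - 2 := by linarith
  have hp0' := hp0.le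
  have hqp : Continuous fun t => |q t| ^ p := by fun_prop (disch := assumption)
  have hwp : Continuous fun t => |deriv w t| ^ p := by fun_prop (disch := assumption)
  have hwi : Integrable fun t => |deriv w t| ^ p := integrable_abs_rpow hdc hc.deriv hp0
  set D : ℝ → ℝ := fun t => p * |q t| ^ (p - 2) * q t * deriv w t - (p - 1) * |q t| ^ p with hD
  have hDc : Continuous D := by fun_prop (disch := assumption)
  have hpt : ∀ t, κ ^ p * |q t| ^ p + κ ^ (p - 1) * D t ≤ |deriv w t| ^ p := by
    intro t
    have h := tangent_le_abs_rpow (by linarith : 1 < p) (κ * q t) (deriv w t)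
    have e1 : |κ * q t| ^ p = κ ^ p * |q t| ^ p := by
      rw [abs_mul, abs_of_pos hκ0, Real.mul_rpow hκ0.le (abs_nonneg _)]
    have e2 : |κ * q t| ^ (p - 2) = κ ^ (p - 2) * |q t| ^ (p - 2) := by
      rw [abs_mul, abs_of_pos hκ0, Real.mul_rpow hκ0.le (abs_nonneg _)]
    have e3 : κ ^ (p - 1) = κ ^ (p - 2) * κ := by
      rw [← Real.rpow_add_one hκ0.ne']; congr 1; ring
    have e4 : p * κ = p - 1 := by rw [hκ]; field_simp
    have e5 := abs_rpow_sub_two_mul_self_mul_self hp (q t)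
    refine le_trans (le_of_eq ?_) h
    simp only [hD]
    rw [e1, e2, e3, ← e4, ← e5]
    ring
  have hderiv : ∀ t, t ≠ τ₀ → HasDerivAt (fun t => |q t| ^ p * (t - τ₀)) (D t) t := by
    intro t ht
    have ht' : t - τ₀ ≠ 0 := sub_ne_zero.2 ht
    have hqt : q t = (w t - w τ₀) / (t - τ₀) := by
      rw [hq, dslope_of_ne _ ht, slope_def_field]
    have h1 : HasDerivAt q ((deriv w t - q t) / (t - τ₀)) t := by
      have hw' := (hw.differentiable one_ne_zero t).hasDerivAt
      have h := (hw'.sub_const (w τ₀)).div ((hasDerivAt_id t).sub_const τ₀) ht'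
      refine (h.congr_of_eventuallyEq ?_).congr_deriv ?_
      · filter_upwards [isOpen_ne.mem_nhds ht] with s hs
        rw [hq, dslope_of_ne _ hs, slope_def_field]; rfl
      · rw [hqt]; simp only [id]; field_simp
    have h3 := ((hasDerivAt_abs_rpow (q t) (by linarith : 1 < p)).comp t h1).mul
      ((hasDerivAt_id t).sub_const τ₀)
    refine h3.congr_deriv ?_
    simp only [hD, Function.comp, id]
    rw [← abs_rpow_sub_two_mul_self_mul_self hp (q t)]
    field_simp
    ring
  have hint : ∀ T : ℝ, 0 ≤ T →
      κ ^ p * ∫ t in (τ₀ - T)..(τ₀ + T), |q t| ^ p ≤ ∫ t, |deriv w t| ^ p := by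
    intro T hT
    have hle : τ₀ - T ≤ τ₀ + T := by linarith
    have h1 : ∫ t in (τ₀ - T)..(τ₀ + T), D t =
        |q (τ₀ + T)| ^ p * (τ₀ + T - τ₀) - |q (τ₀ - T)| ^ p * (τ₀ - T - τ₀) :=
      integral_eq_of_hasDerivAt_off_countable (fun t => |q t| ^ p * (t - τ₀)) D
        (Set.countable_singleton τ₀) (by fun_prop) (fun t ht => hderiv t ht.2)
        (hDc.intervalIntegrable _ _)
    have h2 : 0 ≤ ∫ t in (τ₀ - T)..(τ₀ + T), D t := by
      rw [h1]
      have h3 : 0 ≤ |q (τ₀ + T)| ^ p * T := by positivity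
      have h4 : 0 ≤ |q (τ₀ - T)| ^ p * T := by positivity
      linarith
    have h3 : ∫ t in (τ₀ - T)..(τ₀ + T), (κ ^ p * |q t| ^ p + κ ^ (p - 1) * D t) ≤
        ∫ t in (τ₀ - T)..(τ₀ + T), |deriv w t| ^ p :=
      intervalIntegral.integral_mono_on hle
        (Continuous.intervalIntegrable (by fun_prop) _ _) (hwp.intervalIntegrable _ _)
        fun t _ => hpt t
    rw [intervalIntegral.integral_add ((hqp.const_mul _).intervalIntegrable _ _)
      ((hDc.const_mul _).intervalIntegrable _ _), intervalIntegral.integral_const_mul,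
      intervalIntegral.integral_const_mul] at h3
    have h4 : ∫ t in (τ₀ - T)..(τ₀ + T), |deriv w t| ^ p ≤ ∫ t, |deriv w t| ^ p := by
      rw [intervalIntegral.integral_of_le hle]
      exact setIntegral_le_integral hwi (Filter.Eventually.of_forall fun t => by positivity)
    have h5 : 0 ≤ κ ^ (p - 1) * ∫ t in (τ₀ - T)..(τ₀ + T), D t := by positivity
    linarith
  have ha : Filter.Tendsto (fun T : ℝ => τ₀ - T) Filter.atTop Filter.atBot := by
    simpa [sub_eq_add_neg] using
      Filter.tendsto_atBot_add_const_left _ τ₀ Filter.tendsto_neg_atTop_atBot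
  have hb : Filter.Tendsto (fun T : ℝ => τ₀ + T) Filter.atTop Filter.atTop :=
    Filter.tendsto_atTop_add_const_left _ τ₀ Filter.tendsto_id
  have hqi : Integrable (fun t => |q t| ^ p) := by
    refine integrable_of_intervalIntegral_norm_bounded ((∫ t, |deriv w t| ^ p) / κ ^ p)
      (fun T => (hqp.integrableOn_Icc).mono_set Set.Ioc_subset_Icc_self) ha hb ?_
    filter_upwards [Filter.eventually_ge_atTop 0] with T hT
    rw [le_div_iff₀ (by positivity), mul_comm]
    simpa [abs_of_nonneg, Real.rpow_nonneg] using hint T hT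
  refine ⟨hqi, ?_⟩
  refine le_of_tendsto ((intervalIntegral_tendsto_integral hqi ha hb).const_mul (κ ^ p)) ?_
  filter_upwards [Filter.eventually_ge_atTop 0] with T hT
  exact hint T hT

theorem hardy_dslope_remainder {p : ℝ} (hp : 2 ≤ p) {w : ℝ → ℝ} (hw : ContDiff ℝ 1 w)
    (hc : HasCompactSupport w) (τ₀ : ℝ) :
    ∫⁻ t, ENNReal.ofReal (((p - 1) / p) ^ p * |w t| ^ p +
        cFS p * ((p - 1) / p) ^ p * |dslope w τ₀ t| ^ p) ≤
      ∫⁻ t, ENNReal.ofReal (|deriv w t + (p - 1) / p * w t| ^ p) := by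
  obtain ⟨hqi, hH⟩ := hardy_dslope hp hw hc τ₀
  set κ := (p - 1) / p with hκ
  have hp0 : 0 < p := by linarith
  have hκ0 : 0 < κ := div_pos (by linarith) hp0
  have hcn := cFS_nonneg hp
  have hdc : Continuous (deriv w) := hw.continuous_deriv le_rfl
  have hwi : Integrable fun t => |w t| ^ p := integrable_abs_rpow hw.continuous hc hp0
  have hdi : Integrable fun t => |deriv w t| ^ p := integrable_abs_rpow hdc hc.deriv hp0
  have hli : Integrable fun t => |deriv w t + κ * w t| ^ p :=
    integrable_abs_rpow (hdc.add (hw.continuous.const_mul κ)) (hc.deriv.add hc.mul_left) hp0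
  have hmi : Integrable fun t => p * |w t| ^ (p - 2) * w t * deriv w t := by
    have : 0 ≤ p - 2 := by linarith
    have := hw.continuous
    exact Continuous.integrable_of_hasCompactSupport (by fun_prop (disch := assumption))
      hc.deriv.mul_left
  have hm0 : ∫ t, p * |w t| ^ (p - 2) * w t * deriv w t = 0 :=
    integral_eq_zero_of_hasDerivAt_of_integrable (fun t =>
      (hasDerivAt_abs_rpow (w t) (by linarith : 1 < p)).comp t
        (hw.differentiable one_ne_zero t).hasDerivAt) hmi hwi
  have hpt : ∀ t, κ ^ p * |w t| ^ p + κ ^ (p - 1) * (p * |w t| ^ (p - 2) * w t * deriv w t) +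
      cFS p * |deriv w t| ^ p ≤ |deriv w t + κ * w t| ^ p := by
    intro t
    have h := cFS_mul_abs_rpow_le hp (κ * w t) (deriv w t)
    have e1 : |κ * w t| ^ p = κ ^ p * |w t| ^ p := by
      rw [abs_mul, abs_of_pos hκ0, Real.mul_rpow hκ0.le (abs_nonneg _)]
    have e2 : |κ * w t| ^ (p - 2) = κ ^ (p - 2) * |w t| ^ (p - 2) := by
      rw [abs_mul, abs_of_pos hκ0, Real.mul_rpow hκ0.le (abs_nonneg _)]
    have e3 : κ ^ (p - 1) = κ ^ (p - 2) * κ := by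
      rw [← Real.rpow_add_one hκ0.ne']; congr 1; ring
    rw [add_comm (deriv w t)]
    refine le_trans (le_of_eq ?_) h
    rw [e1, e2, e3]
    ring
  have hint := integral_mono (((hwi.const_mul (κ ^ p)).add (hmi.const_mul (κ ^ (p - 1)))).add
    (hdi.const_mul (cFS p))) hli hpt
  rw [integral_add' ((hwi.const_mul (κ ^ p)).add (hmi.const_mul (κ ^ (p - 1))))
    (hdi.const_mul (cFS p)), integral_add' (hwi.const_mul (κ ^ p)) (hmi.const_mul (κ ^ (p - 1))),
    integral_const_mul, integral_const_mul, integral_const_mul, hm0] at hint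
  rw [← ofReal_integral_eq_lintegral_ofReal
      (f := fun t => κ ^ p * |w t| ^ p + cFS p * κ ^ p * |dslope w τ₀ t| ^ p)
      ((hwi.const_mul _).add (hqi.const_mul _))
      (Filter.Eventually.of_forall fun t => by simp only [Pi.zero_apply]; positivity),
    ← ofReal_integral_eq_lintegral_ofReal hli
      (Filter.Eventually.of_forall fun t => by simp only [Pi.zero_apply]; positivity)]
  apply ENNReal.ofReal_le_ofReal
  rw [integral_add (hwi.const_mul _) (hqi.const_mul _), integral_const_mul, integral_const_mul]
  have := mul_le_mul_of_nonneg_left hH hcn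
  linarith

/-- Anisotropic dilations `(x, t) ↦ (s x, s² t)` of the Grushin space. -/
def gDil {n : ℕ} (s : ℝ) (z : GPt n) : GPt n := (s • z.1, s ^ 2 * z.2)

theorem gDil_gDil {n : ℕ} (s r : ℝ) (z : GPt n) : gDil s (gDil r z) = gDil (s * r) z := by
  simp [gDil, smul_smul, mul_pow, mul_assoc]

theorem gDil_one {n : ℕ} (z : GPt n) : gDil 1 z = z := by simp [gDil]

theorem continuous_gDil {n : ℕ} : Continuous fun a : ℝ × GPt n => gDil a.1 a.2 := by
  unfold gDil; fun_prop

theorem gNorm_nonneg {n : ℕ} (z : GPt n) : 0 ≤ gNorm z := by unfold gNorm; positivity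

theorem gNorm_gDil {n : ℕ} {s : ℝ} (hs : 0 ≤ s) (z : GPt n) : gNorm (gDil s z) = s * gNorm z := by
  have h : ‖s • z.1‖ ^ 4 + 4 * (s ^ 2 * z.2) ^ 2 = s ^ 4 * (‖z.1‖ ^ 4 + 4 * z.2 ^ 2) := by
    rw [norm_smul, Real.norm_of_nonneg hs]; ring
  simp only [gNorm, gDil]
  rw [h, Real.mul_rpow (by positivity) (by positivity), ← Real.rpow_natCast, ← Real.rpow_mul hs]
  norm_num

theorem gNorm_eq_zero {n : ℕ} {z : GPt n} : gNorm z = 0 ↔ z = 0 := by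
  unfold gNorm
  rw [Real.rpow_eq_zero (by positivity) (by norm_num)]
  constructor
  · intro h
    have h1 : ‖z.1‖ ^ 4 = 0 := by nlinarith [sq_nonneg z.2, pow_nonneg (norm_nonneg z.1) 4]
    have h2 : z.2 ^ 2 = 0 := by nlinarith [sq_nonneg z.2, pow_nonneg (norm_nonneg z.1) 4]
    exact Prod.ext (by simpa using h1) (by simpa using h2)
  · rintro rfl
    simp

theorem gNorm_pos {n : ℕ} {z : GPt n} (hz : z ≠ 0) : 0 < gNorm z :=
  (gNorm_nonneg z).lt_of_ne' fun h => hz (gNorm_eq_zero.1 h)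

theorem continuous_gNorm {n : ℕ} : Continuous (gNorm : GPt n → ℝ) := by
  unfold gNorm
  have : (0 : ℝ) ≤ 1 / 4 := by norm_num
  fun_prop (disch := assumption)

theorem gPsi_nonneg {n : ℕ} (z : GPt n) : 0 ≤ gPsi z := by unfold gPsi; positivity

theorem gPsi_gDil {n : ℕ} {s : ℝ} (hs : 0 < s) (z : GPt n) : gPsi (gDil s z) = gPsi z := by
  unfold gPsi
  rw [gNorm_gDil hs.le]
  simp only [gDil, norm_smul, Real.norm_of_nonneg hs.le]
  rw [mul_pow, mul_pow, mul_div_mul_left _ _ (by positivity)]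

theorem measurable_gPsi {n : ℕ} : Measurable (gPsi : GPt n → ℝ) := by
  unfold gPsi
  have := (continuous_gNorm (n := n)).measurable
  fun_prop

theorem lintegral_comp_gDil {n : ℕ} {F : GPt n → ENNReal} (hF : Measurable F) {s : ℝ}
    (hs : 0 < s) :
    ENNReal.ofReal (s ^ (n + 2)) * ∫⁻ z, F (gDil s z) = ∫⁻ z, F z := by
  have hmap : Measure.map (gDil s) (volume : Measure (GPt n)) =
      ENNReal.ofReal ((s ^ (n + 2))⁻¹) • volume := by
    have h1 := Measure.map_addHaar_smul (volume : Measure (EuclideanSpace ℝ (Fin n))) hs.ne'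
    have h2 := Measure.map_addHaar_smul (volume : Measure ℝ) (r := s ^ 2) (by positivity)
    have hm := Measure.map_prod_map (volume : Measure (EuclideanSpace ℝ (Fin n)))
      (volume : Measure ℝ) (measurable_const_smul s) (measurable_const_smul (s ^ 2))
    have : (gDil s : GPt n → GPt n) = Prod.map (s • ·) (s ^ 2 • ·) := rfl
    rw [this, Measure.volume_eq_prod, ← hm, h1, h2, Measure.prod_smul_left,
      Measure.prod_smul_right, smul_smul, ← ENNReal.ofReal_mul (by positivity)]
    congr 2
    rw [finrank_euclideanSpace_fin, Module.finrank_self, abs_of_nonneg (by positivity),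
      abs_of_nonneg (by positivity), ← mul_inv, pow_one, pow_add]
  have hg : Measurable (gDil s : GPt n → GPt n) :=
    (continuous_gDil.comp (Continuous.prodMk_right s)).measurable
  rw [← lintegral_map hF hg, hmap, lintegral_smul_measure, smul_eq_mul, ← mul_assoc,
    ← ENNReal.ofReal_mul (by positivity), mul_inv_cancel₀ (by positivity)]
  simp

theorem lintegral_Ioc_inv {a b : ℝ} (ha : 0 < a) (hab : a ≤ b) :
    ∫⁻ x in Set.Ioc a b, ENNReal.ofReal x⁻¹ = ENNReal.ofReal (Real.log (b / a)) := by
  have hi : IntegrableOn (fun x : ℝ => x⁻¹) (Set.Ioc a b) :=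
    (intervalIntegrable_iff_integrableOn_Ioc_of_le hab).1
      (intervalIntegral.intervalIntegrable_inv (fun x hx => by
        rw [Set.uIcc_of_le hab] at hx; linarith [hx.1]) continuousOn_id)
  rw [← integral_inv_of_pos ha (by linarith), intervalIntegral.integral_of_le hab,
    ofReal_integral_eq_lintegral_ofReal hi]
  filter_upwards [ae_restrict_mem measurableSet_Ioc] with x hx
  exact inv_nonneg.2 (by linarith [hx.1])

/-- The gauge annulus `{1 ≤ ϱ < e}`, which meets each dilation orbit in a set of logarithmic
length one. -/
def gAnnulus (n : ℕ) : Set (GPt n) := {y | 1 ≤ gNorm y ∧ gNorm y < Real.exp 1}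

theorem measurableSet_gAnnulus (n : ℕ) : MeasurableSet (gAnnulus n) := by
  have := (continuous_gNorm (n := n)).measurable
  exact (measurableSet_le measurable_const this).inter (measurableSet_lt this measurable_const)

/-- Integration along dilation orbits, averaged over the gauge annulus. -/
theorem lintegral_eq_lintegral_gAnnulus {n : ℕ} {F : GPt n → ENNReal}
    (hF : Measurable F) :
    ∫⁻ z, F z = ∫⁻ y in gAnnulus n, ∫⁻ s in Set.Ioi (0 : ℝ),
      ENNReal.ofReal (s ^ (n + 1)) * F (gDil s y) := by
  have hA := measurableSet_gAnnulus n
  have hFm : Measurable fun a : GPt n × ℝ => ENNReal.ofReal (a.2 ^ (n + 1)) * F (gDil a.2 a.1) := by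
    have : Measurable fun a : GPt n × ℝ => gDil a.2 a.1 :=
      (continuous_gDil.comp continuous_swap).measurable
    fun_prop
  have hinner : ∀ s : ℝ, 0 < s →
      ∫⁻ y in gAnnulus n, ENNReal.ofReal (s ^ (n + 1)) * F (gDil s y) =
      ∫⁻ z, ENNReal.ofReal s⁻¹ * ((gAnnulus n).indicator 1 (gDil s⁻¹ z) * F z) := by
    intro s hs
    have hs' : Measurable fun z : GPt n => gDil s⁻¹ z :=
      (continuous_gDil.comp (Continuous.prodMk_right s⁻¹)).measurable
    have hG : Measurable fun z => (gAnnulus n).indicator (1 : GPt n → ENNReal) (gDil s⁻¹ z) * F z :=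
      ((measurable_one.indicator hA).comp hs').mul hF
    rw [lintegral_const_mul' _ _ ENNReal.ofReal_ne_top, lintegral_const_mul' _ _
      ENNReal.ofReal_ne_top, ← lintegral_comp_gDil hG hs, ← mul_assoc,
      ← ENNReal.ofReal_mul (by positivity), ← lintegral_indicator hA]
    congr 2
    · rw [pow_succ s (n + 1)]; field_simp
    · ext z
      rw [gDil_gDil, inv_mul_cancel₀ hs.ne', gDil_one]
      by_cases h : z ∈ gAnnulus n <;> simp [h]
  symm
  rw [lintegral_lintegral_swap hFm.aemeasurable,
    setLIntegral_congr_fun measurableSet_Ioi (fun s hs => hinner s hs),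
    lintegral_lintegral_swap]
  · have hne : ∀ᵐ z : GPt n, z ≠ 0 := by
      have h0 : (volume : Measure (GPt n)) {0} = 0 := by
        rw [Measure.volume_eq_prod]
        exact measure_singleton _
      simpa [ae_iff] using h0
    refine lintegral_congr_ae ?_
    filter_upwards [hne] with z hz
    have hz0 := gNorm_pos hz
    have hE := Real.exp_pos 1
    have h1 : ∀ s ∈ Set.Ioi (0 : ℝ),
        ENNReal.ofReal s⁻¹ * ((gAnnulus n).indicator 1 (gDil s⁻¹ z) * F z) =
        (Set.Ioc (gNorm z / Real.exp 1) (gNorm z)).indicator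
          (fun s => ENNReal.ofReal s⁻¹ * F z) s := by
      intro s hs
      have hs : 0 < s := hs
      have : gDil s⁻¹ z ∈ gAnnulus n ↔ s ∈ Set.Ioc (gNorm z / Real.exp 1) (gNorm z) := by
        simp only [gAnnulus, Set.mem_ofPred_eq, Set.mem_Ioc]
        rw [gNorm_gDil (by positivity), inv_mul_eq_div, le_div_iff₀ hs, div_lt_iff₀ hs,
          div_lt_iff₀ hE, one_mul, mul_comm s, and_comm]
      by_cases h : s ∈ Set.Ioc (gNorm z / Real.exp 1) (gNorm z)
      · rw [Set.indicator_of_mem h, Set.indicator_of_mem (this.2 h)]; simp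
      · rw [Set.indicator_of_notMem h, Set.indicator_of_notMem (fun h' => h (this.1 h'))]; simp
    rw [setLIntegral_congr_fun measurableSet_Ioi h1, lintegral_indicator measurableSet_Ioc,
      Measure.restrict_restrict measurableSet_Ioc, Set.inter_eq_left.2,
      lintegral_mul_const _ (by fun_prop), lintegral_Ioc_inv (by positivity)]
    · rw [div_div_cancel₀ hz0.ne', Real.log_exp]; simp
    · exact div_le_self hz0.le (Real.one_le_exp zero_le_one)
    · intro s hs
      exact lt_trans (by positivity) hs.1
  · apply Measurable.aemeasurable
    have : Measurable fun a : ℝ × GPt n => gDil a.1⁻¹ a.2 :=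
      continuous_gDil.measurable.comp (measurable_fst.inv.prodMk measurable_snd)
    have := (measurable_one.indicator hA : Measurable
      ((gAnnulus n).indicator (1 : GPt n → ENNReal))).comp this
    simp only [Function.uncurry_def]
    exact (by fun_prop : Measurable fun a : ℝ × GPt n => ENNReal.ofReal a.1⁻¹).mul
      (this.mul (hF.comp measurable_snd))

/-- Emden–Fowler coordinate `τ ↦ exp (-exp τ)` on the unit interval. -/
def efMap (τ : ℝ) : ℝ := Real.exp (-Real.exp τ)

theorem efMap_pos (τ : ℝ) : 0 < efMap τ := Real.exp_pos _

theorem efMap_lt_one (τ : ℝ) : efMap τ < 1 := by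
  unfold efMap
  rw [Real.exp_lt_one_iff]
  linarith [Real.exp_pos τ]

theorem hasDerivAt_efMap (τ : ℝ) : HasDerivAt efMap (-(efMap τ * Real.exp τ)) τ :=
  ((Real.hasDerivAt_exp τ).neg.exp).congr_deriv (by simp [efMap])

theorem efMap_injective : Function.Injective efMap := by
  intro a b h
  simpa [efMap] using h

theorem log_one_div_efMap (τ : ℝ) : Real.log (1 / efMap τ) = Real.exp τ := by
  simp [efMap]

theorem efMap_log_log {s : ℝ} (h0 : 0 < s) (h1 : s < 1) :
    efMap (Real.log (Real.log (1 / s))) = s := by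
  have : 0 < Real.log (1 / s) := Real.log_pos (by rw [lt_div_iff₀ h0]; linarith)
  rw [efMap, Real.exp_log this, one_div, Real.log_inv, neg_neg, Real.exp_log h0]

/-- Integration over the punctured unit gauge ball in Emden–Fowler coordinates. -/
theorem setLIntegral_unitBall {n : ℕ} {F : GPt n → ENNReal} (hF : Measurable F) :
    ∫⁻ z in {z : GPt n | gNorm z < 1}, F z =
      ∫⁻ y in gAnnulus n, ENNReal.ofReal ((gNorm y)⁻¹ ^ (n + 2)) *
        ∫⁻ τ, ENNReal.ofReal (efMap τ ^ (n + 2) * Real.exp τ) *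
          F (gDil (efMap τ) (gDil (gNorm y)⁻¹ y)) := by
  have hB : MeasurableSet {z : GPt n | gNorm z < 1} :=
    measurableSet_lt continuous_gNorm.measurable measurable_const
  rw [← lintegral_indicator hB, lintegral_eq_lintegral_gAnnulus (hF.indicator hB)]
  refine setLIntegral_congr_fun (measurableSet_gAnnulus n) fun y hy => ?_
  have hy0 : 0 < gNorm y := lt_of_lt_of_le one_pos hy.1
  set ρ := gNorm y with hρ
  have himg : (fun τ => efMap τ * ρ⁻¹) '' Set.univ = Set.Ioo 0 ρ⁻¹ := by
    ext s
    simp only [Set.image_univ, Set.mem_range, Set.mem_Ioo]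
    constructor
    · rintro ⟨τ, rfl⟩
      exact ⟨mul_pos (efMap_pos τ) (by positivity),
        mul_lt_of_lt_one_left (by positivity) (efMap_lt_one τ)⟩
    · rintro ⟨h0, h1⟩
      refine ⟨Real.log (Real.log (1 / (s * ρ))), ?_⟩
      rw [efMap_log_log (by positivity) (by rwa [← lt_div_iff₀ hy0, one_div])]
      field_simp
  have hstep : ∀ s ∈ Set.Ioi (0 : ℝ), ENNReal.ofReal (s ^ (n + 1)) *
      Set.indicator {z : GPt n | gNorm z < 1} F (gDil s y) =
      (Set.Ioo 0 ρ⁻¹).indicator (fun s => ENNReal.ofReal (s ^ (n + 1)) * F (gDil s y)) s := by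
    intro s hs
    have hs : 0 < s := hs
    have : gDil s y ∈ {z : GPt n | gNorm z < 1} ↔ s ∈ Set.Ioo 0 ρ⁻¹ := by
      simp only [Set.mem_ofPred_eq, Set.mem_Ioo, hs, true_and]
      rw [gNorm_gDil hs.le, ← hρ, ← lt_div_iff₀ hy0, one_div]
    by_cases h : s ∈ Set.Ioo 0 ρ⁻¹
    · rw [Set.indicator_of_mem h, Set.indicator_of_mem (this.2 h)]
    · rw [Set.indicator_of_notMem h, Set.indicator_of_notMem (fun h' => h (this.1 h'))]; simp
  rw [setLIntegral_congr_fun measurableSet_Ioi hstep, lintegral_indicator measurableSet_Ioo,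
    Measure.restrict_restrict measurableSet_Ioo, Set.inter_eq_left.2 (fun s hs => hs.1), ← himg,
    lintegral_image_eq_lintegral_abs_deriv_mul MeasurableSet.univ
      (fun τ _ => ((hasDerivAt_efMap τ).mul_const ρ⁻¹).hasDerivWithinAt)
      (fun a _ b _ h => efMap_injective (mul_right_cancel₀ (by positivity) h)),
    setLIntegral_univ, ← lintegral_const_mul' _ _ ENNReal.ofReal_ne_top]
  refine lintegral_congr fun τ => ?_
  have hτ := efMap_pos τ
  rw [gDil_gDil, ← mul_assoc, ← mul_assoc, ← ENNReal.ofReal_mul (by positivity),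
    ← ENNReal.ofReal_mul (by positivity)]
  congr 2
  rw [neg_mul, abs_neg, abs_of_nonneg (by positivity), mul_pow]
  ring

theorem hasDerivAt_gDil {n : ℕ} (s : ℝ) (z : GPt n) :
    HasDerivAt (fun s : ℝ => gDil s z) (z.1, 2 * s * z.2) s := by
  have h1 : HasDerivAt (fun s : ℝ => s • z.1) z.1 s := by
    simpa using (hasDerivAt_id s).smul_const z.1
  have h2 : HasDerivAt (fun s : ℝ => s ^ 2 * z.2) (2 * s * z.2) s := by
    simpa using (hasDerivAt_pow 2 s).mul_const z.2
  exact h1.prodMk h2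

theorem uScaled_eq {n : ℕ} (R : ℝ) (u : GPt n → ℝ) (z : GPt n) :
    uScaled R u z = u (gDil (R / gNorm z) z) := by
  simp [uScaled, gDil, div_pow]

theorem radialDeriv_gDil {n : ℕ} (u : GPt n → ℝ) {σ : GPt n} (hσ : gNorm σ = 1) {s : ℝ}
    (hs : 0 < s) : radialDeriv u (gDil s σ) = deriv (fun r => u (gDil r σ)) s := by
  have h : gNorm (gDil s σ) = s := by rw [gNorm_gDil hs.le, hσ, mul_one]
  have := fun r => uScaled_eq r u (gDil s σ)
  unfold uScaled at this
  unfold radialDeriv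
  simp_rw [this]
  rw [h]
  congr 1
  ext r
  rw [gDil_gDil, div_mul_cancel₀ _ hs.ne']

theorem radialDeriv_eq_fderiv {n : ℕ} {u : GPt n → ℝ} (hu : Differentiable ℝ u) (z : GPt n) :
    radialDeriv u z = fderiv ℝ u z ((gNorm z)⁻¹ • z.1, 2 * (gNorm z)⁻¹ * z.2) := by
  rcases eq_or_ne z 0 with rfl | hz
  · simp [radialDeriv, ← Prod.zero_eq_mk]
  have hρ := gNorm_pos hz
  have := fun r => uScaled_eq r u z
  unfold uScaled at this
  unfold radialDeriv
  simp_rw [this]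
  set ρ := gNorm z
  have h1 : HasDerivAt (fun s : ℝ => s / ρ) ρ⁻¹ ρ := by
    simpa using (hasDerivAt_id ρ).div_const ρ
  have h2 := (hasDerivAt_gDil (ρ / ρ) z).scomp (h := fun s : ℝ => s / ρ) ρ h1
  have e : gDil (ρ / ρ) z = z := by rw [div_self hρ.ne', gDil_one]
  have h3 : HasFDerivAt u (fderiv ℝ u z) (gDil (ρ / ρ) z) := by
    rw [e]
    exact (hu z).hasFDerivAt
  have h4 : HasDerivAt (fun s : ℝ => u (gDil (s / ρ) z)) _ ρ := h3.comp_hasDerivAt ρ h2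
  rw [h4.deriv]
  congr 1
  ext
  · simp
  · simp [div_self hρ.ne']
    ring

theorem measurable_radialDeriv {n : ℕ} {u : GPt n → ℝ} (hu : ContDiff ℝ 1 u) :
    Measurable (radialDeriv u) := by
  have h : Continuous fun a : GPt n × GPt n => fderiv ℝ u a.1 a.2 :=
    hu.continuous_fderiv_apply one_ne_zero
  have hρ := (continuous_gNorm (n := n)).measurable
  have hm : Measurable fun z : GPt n => (z, ((gNorm z)⁻¹ • z.1, 2 * (gNorm z)⁻¹ * z.2)) := by
    fun_prop
  have := h.measurable.comp hm
  convert this using 1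
  ext z
  exact radialDeriv_eq_fderiv (hu.differentiable one_ne_zero) z

/-- Density of the weighted radial Dirichlet energy. -/
def critEnergy {n : ℕ} (Q p : ℝ) (u : GPt n → ℝ) (z : GPt n) : ℝ :=
  gPsi z ^ (p / 2) * |radialDeriv u z| ^ p / gNorm z ^ (Q - p)

/-- Density of the critical Hardy potential term. -/
def critPotential {n : ℕ} (Q p : ℝ) (u : GPt n → ℝ) (z : GPt n) : ℝ :=
  |u z| ^ p * gPsi z ^ (p / 2) / (gNorm z ^ Q * Real.log (1 / gNorm z) ^ p)

/-- Density of `d_C(u,R)^p`. -/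
def critDistance {n : ℕ} (Q p R : ℝ) (u : GPt n → ℝ) (z : GPt n) : ℝ :=
  |u z - Real.log (1 / gNorm z) ^ ((p - 1) / p) * R ^ ((p - 1) / p) *
      uScaled (Real.exp (-1 / R)) u z| ^ p * gPsi z ^ (p / 2) /
    (gNorm z ^ Q * Real.log (1 / gNorm z) ^ p * |Real.log (R * Real.log (1 / gNorm z))| ^ p)

theorem integrable_critEnergy {n : ℕ} {Q p : ℝ} (hp : 0 < p) {u : GPt n → ℝ}
    (hu : ContDiff ℝ 1 u) (hc : HasCompactSupport u) (h0 : (0 : GPt n) ∉ tsupport u) :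
    Integrable (critEnergy Q p u) := by
  have hzero : ∀ z, z ∉ tsupport u → critEnergy Q p u z = 0 := by
    intro z hz
    have : fderiv ℝ u z = 0 := by
      by_contra h
      exact hz (support_fderiv_subset ℝ h)
    simp [critEnergy, radialDeriv_eq_fderiv (hu.differentiable one_ne_zero), this,
      Real.zero_rpow hp.ne']
  refine Continuous.integrable_of_hasCompactSupport ?_ (HasCompactSupport.intro hc hzero)
  rw [continuous_iff_continuousAt]
  intro z
  by_cases hz : z ∈ tsupport u
  · have hz0 : z ≠ 0 := fun h => h0 (h ▸ hz)
    have hρ : ContinuousAt gNorm z := continuous_gNorm.continuousAt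
    have hρ0 : gNorm z ≠ 0 := (gNorm_pos hz0).ne'
    have hψ : ContinuousAt gPsi z := by
      unfold gPsi
      have : gNorm z ^ 2 ≠ 0 := pow_ne_zero _ hρ0
      fun_prop (disch := assumption)
    have hd : ContinuousAt (radialDeriv u) z := by
      have h : Continuous fun a : GPt n × GPt n => fderiv ℝ u a.1 a.2 :=
        hu.continuous_fderiv_apply one_ne_zero
      have hm : ContinuousAt
          (fun z : GPt n => (z, ((gNorm z)⁻¹ • z.1, 2 * (gNorm z)⁻¹ * z.2))) z := by
        fun_prop (disch := assumption)
      have := ContinuousAt.comp (g := fun a : GPt n × GPt n => fderiv ℝ u a.1 a.2)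
        h.continuousAt hm
      convert this using 1
      ext z
      exact radialDeriv_eq_fderiv (hu.differentiable one_ne_zero) z
    unfold critEnergy
    exact ((hψ.rpow_const (Or.inr (by positivity))).mul
      (hd.abs.rpow_const (Or.inr hp.le))).div (hρ.rpow_const (Or.inl hρ0))
      (Real.rpow_pos_of_pos (gNorm_pos hz0) _).ne'
  · have : critEnergy Q p u =ᶠ[nhds z] fun _ => 0 := by
      filter_upwards [(isClosed_tsupport u).isOpen_compl.mem_nhds hz] with y hy
      exact hzero y hy
    exact continuousAt_const.congr this.symm

theorem measurable_critPotential {n : ℕ} {Q p : ℝ} {u : GPt n → ℝ} (hu : Continuous u) :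
    Measurable (critPotential Q p u) := by
  have hρ := (continuous_gNorm (n := n)).measurable
  have hψ := measurable_gPsi (n := n)
  have := hu.measurable
  unfold critPotential
  fun_prop

theorem measurable_critDistance {n : ℕ} {Q p R : ℝ} {u : GPt n → ℝ} (hu : Continuous u) :
    Measurable (critDistance Q p R u) := by
  have hρ := (continuous_gNorm (n := n)).measurable
  have hψ := measurable_gPsi (n := n)
  have := hu.measurable
  have : Measurable (uScaled (Real.exp (-1 / R)) u) := by
    unfold uScaled
    fun_prop
  unfold critDistance
  fun_prop

theorem measurable_critEnergy {n : ℕ} {Q p : ℝ} {u : GPt n → ℝ} (hu : ContDiff ℝ 1 u) :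
    Measurable (critEnergy Q p u) := by
  have hρ := (continuous_gNorm (n := n)).measurable
  have hψ := measurable_gPsi (n := n)
  have := measurable_radialDeriv hu
  unfold critEnergy
  fun_prop

/-- The profile of `u` along the orbit of `σ`, divided by the virtual ground state. -/
def efProfile {n : ℕ} (p : ℝ) (u : GPt n → ℝ) (σ : GPt n) (τ : ℝ) : ℝ :=
  u (gDil (efMap τ) σ) * Real.exp (-((p - 1) / p * τ))

theorem contDiff_efProfile {n : ℕ} {p : ℝ} {u : GPt n → ℝ} (hu : ContDiff ℝ 1 u) (σ : GPt n) :
    ContDiff ℝ 1 (efProfile p u σ) := by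
  have : ContDiff ℝ 1 fun τ => gDil (efMap τ) σ := by
    unfold gDil efMap
    fun_prop
  unfold efProfile
  fun_prop

theorem hasCompactSupport_efProfile {n : ℕ} {p : ℝ} {u : GPt n → ℝ} (hc : HasCompactSupport u)
    (hsub : tsupport u ⊆ {z : GPt n | gNorm z < 1 ∧ z ≠ 0}) {σ : GPt n} (hσ : gNorm σ = 1) :
    HasCompactSupport (efProfile p u σ) := by
  have hcont : ContinuousOn (fun z : GPt n => Real.log (Real.log (1 / gNorm z))) (tsupport u) := by
    intro z hz
    obtain ⟨h1, h0⟩ := hsub hz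
    have hρ0 := gNorm_pos h0
    have hlog : Real.log (1 / gNorm z) ≠ 0 :=
      (Real.log_pos (by rw [lt_div_iff₀ hρ0]; linarith)).ne'
    have : (1 : ℝ) / gNorm z ≠ 0 := by positivity
    exact ((((continuousAt_const.div continuous_gNorm.continuousAt hρ0.ne').log this).log
      hlog)).continuousWithinAt
  refine HasCompactSupport.intro (hc.isCompact.image_of_continuousOn hcont) fun τ hτ => ?_
  have : gDil (efMap τ) σ ∉ tsupport u := by
    intro h
    refine hτ ⟨_, h, ?_⟩
    simp only
    rw [gNorm_gDil (efMap_pos τ).le, hσ, mul_one, log_one_div_efMap, Real.log_exp]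
  simp [efProfile, image_eq_zero_of_notMem_tsupport this]

theorem abs_mul_exp_rpow {p : ℝ} (hp : p ≠ 0) (g τ : ℝ) :
    |g * Real.exp (-((p - 1) / p * τ))| ^ p = |g| ^ p * (Real.exp τ / Real.exp τ ^ p) := by
  rw [abs_mul, Real.mul_rpow (abs_nonneg _) (abs_nonneg _), Real.abs_exp, ← Real.exp_mul,
    ← Real.exp_mul, ← Real.exp_sub]
  congr 2
  field_simp
  ring

section Orbit

variable {n : ℕ} {Q p : ℝ} {u : GPt n → ℝ} {σ : GPt n}

theorem critPotential_gDil (hQ : Q = n + 2) (hp : 0 < p) (hσ : gNorm σ = 1) (τ : ℝ) :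
    efMap τ ^ (n + 2) * Real.exp τ * critPotential Q p u (gDil (efMap τ) σ) =
      gPsi σ ^ (p / 2) * |efProfile p u σ τ| ^ p := by
  have hs := efMap_pos τ
  have hE := Real.exp_pos τ
  have e : efMap τ ^ Q = efMap τ ^ (n + 2) := by rw [hQ]; exact_mod_cast Real.rpow_natCast _ (n + 2)
  unfold critPotential efProfile
  rw [gPsi_gDil hs, gNorm_gDil hs.le, hσ, mul_one, log_one_div_efMap, abs_mul_exp_rpow hp.ne', e]
  field_simp

theorem critEnergy_gDil (hQ : Q = n + 2) (hp : 0 < p) (hu : Differentiable ℝ u)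
    (hσ : gNorm σ = 1) (τ : ℝ) :
    efMap τ ^ (n + 2) * Real.exp τ * critEnergy Q p u (gDil (efMap τ) σ) =
      gPsi σ ^ (p / 2) *
        |deriv (efProfile p u σ) τ + (p - 1) / p * efProfile p u σ τ| ^ p := by
  have hs := efMap_pos τ
  have hE := Real.exp_pos τ
  have e : efMap τ ^ (Q - p) = efMap τ ^ (n + 2) / efMap τ ^ p := by
    rw [Real.rpow_sub hs, hQ]
    congr 1
    exact_mod_cast Real.rpow_natCast _ (n + 2)
  set d := deriv (fun r => u (gDil r σ)) (efMap τ) with hd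
  have hg : HasDerivAt (fun r => u (gDil r σ)) d (efMap τ) :=
    (DifferentiableAt.comp (efMap τ) (hu _)
      (hasDerivAt_gDil (efMap τ) σ).differentiableAt).hasDerivAt
  have hw : HasDerivAt (efProfile p u σ) _ τ :=
    (hg.comp τ (hasDerivAt_efMap τ)).mul
      ((hasDerivAt_id τ).const_mul ((p - 1) / p)).fun_neg.exp
  have hsum : deriv (efProfile p u σ) τ + (p - 1) / p * efProfile p u σ τ =
      (-(d * efMap τ * Real.exp τ)) * Real.exp (-((p - 1) / p * τ)) := by
    rw [hw.deriv]
    simp only [efProfile, Function.comp, id]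
    ring
  rw [hsum, abs_mul_exp_rpow hp.ne', abs_neg, abs_mul, abs_mul, abs_of_pos hs, abs_of_pos hE,
    Real.mul_rpow (by positivity) hE.le, Real.mul_rpow (by positivity) hs.le]
  unfold critEnergy
  rw [gPsi_gDil hs, gNorm_gDil hs.le, hσ, mul_one, radialDeriv_gDil u hσ hs, ← hd, e]
  field_simp

theorem critDistance_gDil_le (hQ : Q = n + 2) (hp : 0 < p) (hσ : gNorm σ = 1) {R : ℝ}
    (hR : 0 < R) (τ : ℝ) :
    efMap τ ^ (n + 2) * Real.exp τ * critDistance Q p R u (gDil (efMap τ) σ) ≤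
      gPsi σ ^ (p / 2) * |dslope (efProfile p u σ) (-Real.log R) τ| ^ p := by
  have hs := efMap_pos τ
  have hE := Real.exp_pos τ
  have hψ := gPsi_nonneg σ
  have e : efMap τ ^ Q = efMap τ ^ (n + 2) := by rw [hQ]; exact_mod_cast Real.rpow_natCast _ (n + 2)
  have hlog : Real.log (R * Real.exp τ) = τ - -Real.log R := by
    rw [Real.log_mul hR.ne' hE.ne', Real.log_exp]; ring
  have hw0 : efProfile p u σ (-Real.log R) =
      R ^ ((p - 1) / p) * u (gDil (Real.exp (-1 / R)) σ) := by
    have h1 : efMap (-Real.log R) = Real.exp (-1 / R) := by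
      rw [efMap, Real.exp_neg (Real.log R), Real.exp_log hR]; congr 1; ring
    rw [efProfile, h1, Real.rpow_def_of_pos hR, mul_comm]
    congr 2
    ring
  have hsc : uScaled (Real.exp (-1 / R)) u (gDil (efMap τ) σ) =
      u (gDil (Real.exp (-1 / R)) σ) := by
    rw [uScaled_eq, gNorm_gDil hs.le, hσ, mul_one, gDil_gDil, div_mul_cancel₀ _ hs.ne']
  unfold critDistance
  rw [gPsi_gDil hs, gNorm_gDil hs.le, hσ, mul_one, log_one_div_efMap, hlog, hsc,
    mul_assoc (Real.exp τ ^ ((p - 1) / p)), ← hw0, e]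
  rcases eq_or_ne τ (-Real.log R) with h | h
  · rw [← h]
    simp only [sub_self, abs_zero, Real.zero_rpow hp.ne', mul_zero, div_zero]
    positivity
  · have ht : 0 < |τ - -Real.log R| := abs_pos.2 (sub_ne_zero.2 h)
    have hexp : Real.exp τ ^ ((p - 1) / p) * Real.exp (-((p - 1) / p * τ)) = 1 := by
      rw [← Real.exp_mul, ← Real.exp_add, Real.exp_eq_one_iff]
      ring
    have hdiff : efProfile p u σ τ - efProfile p u σ (-Real.log R) =
        (u (gDil (efMap τ) σ) - Real.exp τ ^ ((p - 1) / p) * efProfile p u σ (-Real.log R)) *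
          Real.exp (-((p - 1) / p * τ)) := by
      rw [sub_mul, mul_right_comm, hexp, one_mul, efProfile]
    rw [dslope_of_ne _ h, slope_def_field, abs_div, Real.div_rpow (abs_nonneg _) (abs_nonneg _),
      hdiff, abs_mul_exp_rpow hp.ne']
    apply le_of_eq
    field_simp

end Orbit

theorem lintegral_stability {n : ℕ} {Q p R : ℝ} (hQ : Q = n + 2) (hp : 2 ≤ p) (hR : 0 < R)
    {u : GPt n → ℝ} (hu : ContDiff ℝ 1 u) (hc : HasCompactSupport u)
    (hsub : tsupport u ⊆ {z : GPt n | gNorm z < 1 ∧ z ≠ 0}) :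
    ∫⁻ z in {z : GPt n | gNorm z < 1}, ENNReal.ofReal (((p - 1) / p) ^ p * critPotential Q p u z +
        cFS p * ((p - 1) / p) ^ p * critDistance Q p R u z) ≤
      ∫⁻ z in {z : GPt n | gNorm z < 1}, ENNReal.ofReal (critEnergy Q p u z) := by
  have hp0 : 0 < p := by linarith
  have hκ : 0 ≤ ((p - 1) / p) ^ p := Real.rpow_nonneg (div_nonneg (by linarith) hp0.le) _
  have hcn := cFS_nonneg hp
  have hP := measurable_critPotential (Q := Q) (p := p) hu.continuous
  have hD := measurable_critDistance (Q := Q) (p := p) (R := R) hu.continuous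
  rw [setLIntegral_unitBall (by fun_prop), setLIntegral_unitBall (measurable_critEnergy hu).ennreal_ofReal]
  refine setLIntegral_mono' (measurableSet_gAnnulus n) fun y hy => ?_
  have hy0 : 0 < gNorm y := lt_of_lt_of_le one_pos hy.1
  set σ := gDil (gNorm y)⁻¹ y
  have hσ : gNorm σ = 1 := by rw [gNorm_gDil (by positivity), inv_mul_cancel₀ hy0.ne']
  have hψ : 0 ≤ gPsi σ ^ (p / 2) := Real.rpow_nonneg (gPsi_nonneg σ) _
  have hpos : ∀ τ, 0 ≤ efMap τ ^ (n + 2) * Real.exp τ := fun τ => by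
    have := efMap_pos τ
    positivity
  gcongr ENNReal.ofReal _ * ?_
  simp_rw [← ENNReal.ofReal_mul (hpos _), critEnergy_gDil hQ hp0 (hu.differentiable one_ne_zero) hσ,
    ENNReal.ofReal_mul hψ]
  rw [lintegral_const_mul' _ _ ENNReal.ofReal_ne_top]
  refine le_trans ?_ (mul_le_mul_right (hardy_dslope_remainder hp (contDiff_efProfile hu σ)
    (hasCompactSupport_efProfile hc hsub hσ) (-Real.log R)) _)
  rw [← lintegral_const_mul' _ _ ENNReal.ofReal_ne_top]
  refine lintegral_mono fun τ => ?_
  rw [← ENNReal.ofReal_mul hψ]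
  apply ENNReal.ofReal_le_ofReal
  have h1 := critPotential_gDil (u := u) hQ hp0 hσ τ
  have h2 := mul_le_mul_of_nonneg_left (critDistance_gDil_le (u := u) hQ hp0 hσ hR τ)
    (mul_nonneg hcn hκ)
  linear_combination ((p - 1) / p) ^ p * h1 + h2

theorem critEnergy_nonneg {n : ℕ} (Q p : ℝ) (u : GPt n → ℝ) (z : GPt n) :
    0 ≤ critEnergy Q p u z := by
  have := gPsi_nonneg z
  have := gNorm_nonneg z
  unfold critEnergy
  positivity

theorem log_one_div_gNorm_nonneg {n : ℕ} {z : GPt n} (hz : gNorm z < 1) :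
    0 ≤ Real.log (1 / gNorm z) := by
  rw [one_div, Real.log_inv, neg_nonneg]
  exact Real.log_nonpos (gNorm_nonneg z) hz.le

theorem critPotential_nonneg {n : ℕ} (Q p : ℝ) (u : GPt n → ℝ) {z : GPt n} (hz : gNorm z < 1) :
    0 ≤ critPotential Q p u z := by
  have := gPsi_nonneg z
  have := gNorm_nonneg z
  have := log_one_div_gNorm_nonneg hz
  unfold critPotential
  positivity

theorem critDistance_nonneg {n : ℕ} (Q p R : ℝ) (u : GPt n → ℝ) {z : GPt n} (hz : gNorm z < 1) :
    0 ≤ critDistance Q p R u z := by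
  have := gPsi_nonneg z
  have := gNorm_nonneg z
  have := log_one_div_gNorm_nonneg hz
  unfold critDistance
  positivity

theorem integral_stability {n : ℕ} {Q p R : ℝ} (hQ : Q = n + 2) (hp : 2 ≤ p) (hR : 0 < R)
    {u : GPt n → ℝ} (hu : ContDiff ℝ 1 u) (hc : HasCompactSupport u)
    (hsub : tsupport u ⊆ {z : GPt n | gNorm z < 1 ∧ z ≠ 0}) :
    ((p - 1) / p) ^ p * (∫ z in {z : GPt n | gNorm z < 1}, critPotential Q p u z) +
        cFS p * ((p - 1) / p) ^ p * (∫ z in {z : GPt n | gNorm z < 1}, critDistance Q p R u z) ≤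
      ∫ z in {z : GPt n | gNorm z < 1}, critEnergy Q p u z := by
  have hp0 : 0 < p := by linarith
  have hκ : 0 < ((p - 1) / p) ^ p := Real.rpow_pos_of_pos (div_pos (by linarith) hp0) _
  have hcn := cFS_nonneg hp
  have hB : MeasurableSet {z : GPt n | gNorm z < 1} :=
    measurableSet_lt continuous_gNorm.measurable measurable_const
  have hP := measurable_critPotential (Q := Q) (p := p) hu.continuous
  have hD := measurable_critDistance (Q := Q) (p := p) (R := R) hu.continuous
  have hEi : IntegrableOn (critEnergy Q p u) {z : GPt n | gNorm z < 1} :=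
    (integrable_critEnergy hp0 hu hc fun h => (hsub h).2 rfl).integrableOn
  have hle := lintegral_stability hQ hp hR hu hc hsub
  have hEe := ofReal_integral_eq_lintegral_ofReal hEi
    (Filter.Eventually.of_forall (critEnergy_nonneg Q p u))
  set S : GPt n → ℝ := fun z => ((p - 1) / p) ^ p * critPotential Q p u z +
    cFS p * ((p - 1) / p) ^ p * critDistance Q p R u z with hS
  have hS0 : ∀ᵐ z ∂volume.restrict {z : GPt n | gNorm z < 1}, 0 ≤ S z := by
    filter_upwards [ae_restrict_mem hB] with z hz
    have := critPotential_nonneg Q p u hz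
    have := critDistance_nonneg Q p R u hz
    positivity
  have hSm : Measurable S := (hP.const_mul _).add (hD.const_mul _)
  have hSi : IntegrableOn S {z : GPt n | gNorm z < 1} := by
    refine ⟨hSm.aestronglyMeasurable, ?_⟩
    rw [hasFiniteIntegral_iff_ofReal hS0]
    exact hle.trans_lt (hEe ▸ ENNReal.ofReal_lt_top)
  have hSe := ofReal_integral_eq_lintegral_ofReal hSi hS0
  have hmain : ∫ z in {z : GPt n | gNorm z < 1}, S z ≤
      ∫ z in {z : GPt n | gNorm z < 1}, critEnergy Q p u z := by
    rw [← hEe, ← hSe] at hle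
    exact (ENNReal.ofReal_le_ofReal_iff (integral_nonneg (critEnergy_nonneg Q p u))).1 hle
  have hPi : IntegrableOn (fun z => ((p - 1) / p) ^ p * critPotential Q p u z)
      {z : GPt n | gNorm z < 1} := by
    refine Integrable.mono' hSi (hP.const_mul _).aestronglyMeasurable ?_
    filter_upwards [ae_restrict_mem hB] with z hz
    have := critPotential_nonneg Q p u hz
    have h3 := critDistance_nonneg Q p R u hz
    rw [Real.norm_of_nonneg (by positivity)]
    have : 0 ≤ cFS p * ((p - 1) / p) ^ p * critDistance Q p R u z := by positivity
    simp only [hS]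
    linarith
  have hDi : IntegrableOn (fun z => cFS p * ((p - 1) / p) ^ p * critDistance Q p R u z)
      {z : GPt n | gNorm z < 1} := by
    refine (hSi.sub hPi).congr (Filter.Eventually.of_forall fun z => ?_)
    simp [hS]
  rw [hS, integral_add hPi hDi, integral_const_mul, integral_const_mul] at hmain
  exact hmain

theorem dCdist_rpow {n : ℕ} (Q : ℝ) {p : ℝ} (hp : 0 < p) (R : ℝ) (u : GPt n → ℝ) :
    dCdist Q p R u ^ p = ∫ z in {z : GPt n | gNorm z < 1}, critDistance Q p R u z := by
  have h : 0 ≤ ∫ z in {z : GPt n | gNorm z < 1}, critDistance Q p R u z :=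
    setIntegral_nonneg (measurableSet_lt continuous_gNorm.measurable measurable_const)
      fun z hz => critDistance_nonneg Q p R u hz
  change ((∫ z in {z : GPt n | gNorm z < 1}, critDistance Q p R u z) ^ (1 / p)) ^ p = _
  rw [← Real.rpow_mul h, one_div_mul_cancel hp.ne', Real.rpow_one]

/-- stability of the critical Hardy inequality on the unit gauge ball
(Theorem 6.2 of the paper). -/
theorem stability_critical_hardy
    (n : ℕ) (Q : ℝ) (hQ : Q = n + 2) (hQ4 : 4 ≤ Q) (p : ℝ) (hp : 2 ≤ p)
    (u : GPt n → ℝ) (hu : IsTest {z : GPt n | gNorm z < 1 ∧ z ≠ 0} u) :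
    (∫ z in {z : GPt n | gNorm z < 1},
        gPsi z ^ (p / 2) * |radialDeriv u z| ^ p / gNorm z ^ (Q - p))
        - ((p - 1) / p) ^ p *
            ∫ z in {z : GPt n | gNorm z < 1},
              |u z| ^ p * gPsi z ^ (p / 2) /
                (gNorm z ^ Q * Real.log (1 / gNorm z) ^ p)
      ≥ cFS p * ((p - 1) / p) ^ p * ⨆ R > (0 : ℝ), dCdist Q p R u ^ p := by
  obtain ⟨hu, hc, hsub⟩ := hu
  have hu1 : ContDiff ℝ 1 u := hu.of_le (by exact_mod_cast le_top)
  have hp0 : 0 < p := by linarith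
  have hC : 0 ≤ cFS p * ((p - 1) / p) ^ p :=
    mul_nonneg (cFS_nonneg hp) (Real.rpow_nonneg (div_nonneg (by linarith) hp0.le) _)
  change cFS p * ((p - 1) / p) ^ p * (⨆ R > (0 : ℝ), dCdist Q p R u ^ p) ≤
    (∫ z in {z : GPt n | gNorm z < 1}, critEnergy Q p u z) -
      ((p - 1) / p) ^ p * ∫ z in {z : GPt n | gNorm z < 1}, critPotential Q p u z
  set I := (∫ z in {z : GPt n | gNorm z < 1}, critEnergy Q p u z) -
      ((p - 1) / p) ^ p * ∫ z in {z : GPt n | gNorm z < 1}, critPotential Q p u z with hI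
  have hR : ∀ R : ℝ, 0 < R → cFS p * ((p - 1) / p) ^ p * dCdist Q p R u ^ p ≤ I := by
    intro R hR
    have := integral_stability hQ hp hR hu1 hc hsub
    rw [dCdist_rpow Q hp0]
    linarith
  have hI0 : 0 ≤ I := by
    refine le_trans (mul_nonneg hC ?_) (hR 1 one_pos)
    rw [dCdist_rpow Q hp0]
    exact setIntegral_nonneg (measurableSet_lt continuous_gNorm.measurable measurable_const)
      fun z hz => critDistance_nonneg Q p 1 u hz
  rw [Real.mul_iSup_of_nonneg hC]
  refine Real.iSup_le (fun R => ?_) hI0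
  rw [Real.mul_iSup_of_nonneg hC]
  exact Real.iSup_le (fun h => hR R h) hI0
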